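/- arXiv:2110.11277 — 3 statements merged into one kernel-verified Lean document; each statement's English description precedes it below -/
import Mathlib

section
/- Assume C_+ > C > 0, A > 0, and p, q ∈ ℝ. Then there exists δ_0 > 0 such that for all δ ∈ (0, δ_0], the integral I_N := ∫_0^δ t^{q−2} e^{−C_+/t} (1 − A t^p e^{−C/t})^{N−1} dt satisfies I_N ∼ η (ln N)^{pβ−q} N^{−β} as N → ∞, where β = C_+/C > 1, η = C^{q−1} (A C^p)^{−β} Γ(β) > 0, and Γ denotes the Gamma function. -/
open MeasureTheory Filter Set Real
open scoped ENNReal Topology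

lemma cov (C δ s : ℝ) (hC : 0 < C) (hδ : 0 < δ) (g : ℝ → ℝ) :
    ∫ t in Ioc 0 δ, g t = ∫ v in Ici (C/δ - s), C/(s+v)^2 * g (C/(s+v)) := by
  have hM : 0 < C/δ := by positivity
  have himg : (fun v => C/(s+v)) '' Ici (C/δ - s) = Ioc 0 δ := by
    ext t
    simp only [mem_image, mem_Ici, mem_Ioc]
    constructor
    · rintro ⟨v, hv, rfl⟩
      have : 0 < s + v := by linarith
      refine ⟨by positivity, ?_⟩
      rw [div_le_iff₀ this]
      have : C/δ ≤ s+v := by linarith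
      rw [div_le_iff₀ hδ] at this
      linarith
    · rintro ⟨h0, h1⟩
      refine ⟨C/t - s, ?_, ?_⟩
      · have : C/δ ≤ C/t := by gcongr
        linarith
      · rw [add_sub_cancel]; field_simp
  rw [← himg, integral_image_eq_integral_abs_deriv_smul (f' := fun v => -C/(s+v)^2) measurableSet_Ici]
  · apply setIntegral_congr_fun measurableSet_Ici
    intro v hv
    simp only [smul_eq_mul, neg_div, abs_neg]
    rw [abs_of_nonneg (by positivity)]
  · intro v hv
    have : 0 < s + v := by have := mem_Ici.1 hv; linarith
    have h := ((hasDerivAt_id v).const_add s).inv this.ne'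
    have h2 := h.const_mul C
    refine (h2.congr_deriv ?_).hasDerivWithinAt
    simp [div_eq_mul_inv]
  · intro a ha b hb hab
    have h1 : 0 < s + a := by have := mem_Ici.1 ha; linarith
    have h2 : 0 < s + b := by have := mem_Ici.1 hb; linarith
    simp only at hab
    field_simp at hab
    linarith

lemma gam (b B : ℝ) (hb : 0 < b) (hB : 0 < B) :
    ∫ v : ℝ, exp (-b*v) * exp (-(B * exp (-v))) = B^(-b) * Real.Gamma b := by
  have h := Real.integral_rpow_mul_exp_neg_mul_Ioi hb hB
  have himg : (fun v : ℝ => exp (-v)) '' univ = Ioi 0 := by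
    ext t
    simp only [image_univ, mem_range, mem_Ioi]
    constructor
    · rintro ⟨v, rfl⟩; positivity
    · intro ht; exact ⟨-log t, by simp [exp_log ht]⟩
  rw [← himg, integral_image_eq_integral_abs_deriv_smul (f' := fun v => -exp (-v)) MeasurableSet.univ] at h
  · rw [one_div, inv_rpow hB.le, ← rpow_neg hB.le] at h
    rw [← h, setIntegral_univ]
    congr 1
    ext v
    simp only [abs_neg, abs_exp, smul_eq_mul]
    rw [← exp_mul]
    simp only [← exp_add]
    congr 1
    ring
  · intro v _
    refine (((hasDerivAt_id v).neg.exp).congr_deriv ?_).hasDerivWithinAt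
    simp
  · intro a _ b _ hab
    simpa using hab

lemma ptw (C Cp A p q u v L s : ℝ) (N : ℕ) (hC : 0 < C) (hA : 0 < A) (hN : 1 ≤ N) (hL : 0 < L)
    (hLN : L = log N) (hs : s = L - p * log L) (hu : u = s + v) (hu0 : 0 < u) :
    C/u^2 * ((C/u)^(q-2) * exp (-Cp/(C/u)) * (1 - A * (C/u)^p * exp (-C/(C/u)))^(N-1)) =
    (C^(q-1) * L^(p*(Cp/C)-q) * (N:ℝ)^(-(Cp/C))) *
     ((u/L)^(-q) * exp (-(Cp/C)*v) * (1 + -((A*C^p) * (u/L)^(-p) * exp (-v)/N))^(N-1)) := by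
  have hN0 : (0:ℝ) < N := by exact_mod_cast hN
  have e1 : A * (C/u)^p * exp (-C/(C/u)) = (A*C^p) * (u/L)^(-p) * exp (-v)/N := by
    have : exp (-C/(C/u)) = exp (-v) / N * L^p := by
      rw [show -C/(C/u) = -v + (-L) + log L * p by rw [hu, hs] at *; field_simp; ring]
      rw [exp_add, exp_add, ← rpow_def_of_pos hL, exp_neg L, hLN, exp_log hN0]; ring
    rw [this, div_rpow hC.le hu0.le, div_rpow hu0.le hL.le, rpow_neg hu0.le, rpow_neg hL.le]
    have := rpow_pos_of_pos hL p
    have := rpow_pos_of_pos hu0 p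
    field_simp
  rw [e1, ← sub_eq_add_neg]
  have e2 : C/u^2 * ((C/u)^(q-2) * exp (-Cp/(C/u))) = (C^(q-1) * L^(p*(Cp/C)-q) * (N:ℝ)^(-(Cp/C))) *
     ((u/L)^(-q) * exp (-(Cp/C)*v)) := by
    have : exp (-Cp/(C/u)) = exp (-(Cp/C)*v) * (N:ℝ)^(-(Cp/C)) * L^(p*(Cp/C)) := by
      rw [rpow_def_of_pos hN0, rpow_def_of_pos hL, ← exp_add, ← exp_add, ← hLN, hu, hs]
      rw [hu, hs] at hu0
      congr 1; field_simp; ring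
    rw [this, div_rpow hC.le hu0.le, div_rpow hu0.le hL.le, rpow_neg hu0.le, rpow_neg hL.le,
      rpow_sub hL, rpow_sub hC, rpow_sub hC, rpow_sub hu0, rpow_one, rpow_two, rpow_two]
    have := rpow_pos_of_pos hL q
    have := rpow_pos_of_pos hu0 q
    field_simp
  rw [← mul_assoc, e2]; ring

lemma lim1 (g : ℕ → ℝ) (x : ℝ) (hg : Tendsto (fun N : ℕ => N * g N) atTop (𝓝 x)) :
    Tendsto (fun N : ℕ => (1 + g N)^(N-1)) atTop (𝓝 (exp x)) := by
  have h := Real.tendsto_one_add_pow_exp_of_tendsto hg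
  have g0 : Tendsto g atTop (𝓝 0) := by
    have := hg.mul (tendsto_inv_atTop_nhds_zero_nat (𝕜 := ℝ))
    rw [mul_zero] at this
    refine this.congr' ?_
    filter_upwards [eventually_gt_atTop 0] with N hN
    field_simp
  have g1 : Tendsto (fun N => 1 + g N) atTop (𝓝 1) := by simpa using g0.const_add 1
  have := h.div g1 one_ne_zero
  rw [div_one] at this
  refine this.congr' ?_
  filter_upwards [eventually_gt_atTop 0, g1.eventually_ne one_ne_zero] with N hN h1
  obtain ⟨m, rfl⟩ := Nat.exists_eq_succ_of_ne_zero hN.ne'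
  simp only [Pi.div_apply, Nat.succ_eq_add_one, add_tsub_cancel_right] at *
  rw [pow_succ]; field_simp

lemma intg : Integrable (fun v : ℝ => exp (-(1/2) * |v|)) := by
  rw [← integrableOn_univ, ← Iic_union_Ioi (a := (0:ℝ))]
  apply IntegrableOn.union
  · have h : IntegrableOn (fun x : ℝ => exp ((1/2) * x)) (Iic 0) := integrableOn_exp_mul_Iic (by norm_num) 0
    refine h.congr_fun (fun x hx => ?_) measurableSet_Iic
    simp only [abs_of_nonpos (mem_Iic.1 hx)]
    ring_nf
  · have h : IntegrableOn (fun x : ℝ => exp (-(1/2) * x)) (Ioi 0) := integrableOn_exp_mul_Ioi (by norm_num) 0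
    refine h.congr_fun (fun x hx => ?_) measurableSet_Ioi
    simp only [abs_of_pos (mem_Ioi.1 hx)]

/-- log bound -/
lemma logr (M ε : ℝ) (hM : 0 < M) (hε : 0 < ε) : ∃ k : ℝ, 0 ≤ k ∧ ∀ L u v s : ℝ, 1 ≤ L → |L - s| ≤ L/2 →
    u = s + v → M ≤ u → |log (u/L)| ≤ k + ε * |v| := by
  set c := min (1/4) (M/4) with hc
  have hc0 : 0 < c := by positivity
  refine ⟨log 2 + |log c| + |ε - 1 - log ε|, by positivity, ?_⟩
  intro L u v s hL hs hu hMu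
  have hL0 : 0 < L := by linarith
  have hu0 : 0 < u := by linarith
  have hw := abs_nonneg v
  obtain ⟨hs1, hs2⟩ := abs_le.1 hs
  have hl1 : log (1+|v|) ≤ |ε - 1 - log ε| + ε * |v| := by
    have h := log_le_sub_one_of_pos (show 0 < ε * (1+|v|) by positivity)
    rw [log_mul hε.ne' (by positivity)] at h
    have := le_abs_self (ε - 1 - log ε)
    linarith
  have up : log (u/L) ≤ log 2 + log (1+|v|) := by
    rw [← log_mul (by norm_num) (by positivity)]
    apply log_le_log (by positivity)
    rw [div_le_iff₀ hL0]
    nlinarith [le_abs_self v]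
  have lo : log c ≤ log (u/L) + log (1+|v|) := by
    rw [← log_mul (by positivity) (by positivity)]
    apply log_le_log hc0
    rw [div_mul_eq_mul_div, le_div_iff₀ hL0]
    by_cases h : |v| ≤ L/4
    · have : L/4 ≤ u := by linarith [neg_abs_le v]
      have : c ≤ 1/4 := min_le_left _ _
      nlinarith
    · push Not at h
      have : c ≤ M/4 := min_le_right _ _
      nlinarith
  have := log_nonneg (show (1:ℝ) ≤ 2 by norm_num)
  have := neg_abs_le (log c)
  have := abs_nonneg (log c)
  rw [abs_le]
  constructor <;> linarith

lemma expb (m c y : ℝ) (hm : 0 < m) (hc : 0 < c) (hy : 0 < y) : exp (-(c*y)) ≤ (m/c)^m * y^(-m) := by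
  have h : c*y/m ≤ exp (c*y/m) := by linarith [add_one_le_exp (c*y/m)]
  have h2 := rpow_le_rpow (by positivity) h hm.le
  rw [← exp_mul, div_mul_cancel₀ _ hm.ne', show c*y/m = (m/c)⁻¹ * y by field_simp,
    mul_rpow (by positivity) hy.le, inv_rpow (by positivity)] at h2
  rw [exp_neg, rpow_neg hy.le]
  have a1 : 0 < (m/c)^m := by positivity
  have a2 : 0 < y^m := by positivity
  rw [← div_eq_mul_inv, inv_le_comm₀ (exp_pos _) (by positivity)]
  refine le_trans (le_of_eq ?_) h2
  rw [inv_div, div_eq_mul_inv, mul_comm]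

lemma dom (b c : ℝ) (hb : 1 < b) (hc : 0 < c) : ∃ K : ℝ, 0 ≤ K ∧ ∀ v : ℝ,
    exp (-b * v + |v|/2) * exp (-(c * exp (-v - |v|/2))) ≤ K * exp (-(1/2) * |v|) := by
  refine ⟨1 + ((2*b+2)/c)^(2*b+2), by positivity, ?_⟩
  intro v
  have hK : 0 < ((2*b+2)/c)^(2*b+2) := by positivity
  rcases le_total 0 v with hv | hv
  · rw [abs_of_nonneg hv]
    have h1 : exp (-(c * exp (-v - v/2))) ≤ 1 := by
      rw [exp_le_one_iff]; have := exp_pos (-v - v/2); nlinarith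
    have h2 : exp (-b*v + v/2) ≤ exp (-(1/2)*v) := by apply exp_le_exp.2; nlinarith
    have := exp_pos (-b*v+v/2)
    have := exp_pos (-(1/2)*v)
    nlinarith
  · rw [abs_of_nonpos hv]
    have h := expb (2*b+2) c (exp (-v - -v/2)) (by linarith) hc (exp_pos _)
    rw [← exp_mul] at h
    calc _ ≤ exp (-b*v + -v/2) * (((2*b+2)/c)^(2*b+2) * exp ((-v - -v/2) * -(2*b+2))) := by gcongr
      _ = ((2*b+2)/c)^(2*b+2) * exp (-(1/2) * -v) := by
        rw [mul_left_comm, ← exp_add]; ring_nf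
      _ ≤ _ := by gcongr; linarith

lemma fb (b B p q k ε : ℝ) (hB : 0 < B) (hp : |p| * ε ≤ 1/2) (hq : |q| * ε ≤ 1/2)
    (r v : ℝ) (N : ℕ) (hN : 1 ≤ N) (hr : 0 < r) (hlog : |log r| ≤ k + ε * |v|)
    (hx : B * r^(-p) * exp (-v)/N ≤ 1) :
    |r^(-q) * exp (-b*v) * (1 + -(B * r^(-p) * exp (-v)/N))^(N-1)| ≤
      exp (1 + |q| *k) * (exp (-b * v + |v|/2) * exp (-((B * exp (-(|p| *k))) * exp (-v - |v|/2)))) := by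
  have hN0 : (0:ℝ) < N := by exact_mod_cast hN
  have hv := abs_nonneg v
  have ha : ∀ a : ℝ, |a| * ε ≤ 1/2 → |log r * -a| ≤ |a| * k + |v|/2 := by
    intro a ha
    rw [abs_mul, abs_neg]
    have := abs_nonneg a
    nlinarith
  have h1 : r^(-q) ≤ exp (|q| *k + |v|/2) := by
    rw [rpow_def_of_pos hr, exp_le_exp]
    exact (le_abs_self _).trans (ha q hq)
  have h2 : exp (-(|p| *k) - |v|/2) ≤ r^(-p) := by
    rw [rpow_def_of_pos hr, exp_le_exp]
    linarith [neg_abs_le (log r * -p), ha p hp]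
  set x := B * r^(-p) * exp (-v)/N with hxd
  have hx0 : 0 ≤ x := by positivity
  have hNx : (N:ℝ) * x = B * r^(-p) * exp (-v) := by rw [hxd]; field_simp
  have h3 : (1 + -x)^(N-1) ≤ exp (1 - B * exp (-(|p| *k)) * exp (-v - |v|/2)) := by
    calc (1 + -x)^(N-1) ≤ exp (-x)^(N-1) := by
          apply pow_le_pow_left₀ (by linarith)
          linarith [add_one_le_exp (-x)]
      _ = exp (x - N * x) := by
          rw [← exp_nat_mul]; push_cast [Nat.cast_sub hN]; ring_nf
      _ ≤ _ := by
          rw [exp_le_exp, hNx]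
          have : B * exp (-(|p| *k)) * exp (-v - |v|/2) ≤ B * r^(-p) * exp (-v) := by
            calc _ = B * exp (-(|p| *k) - |v|/2) * exp (-v) := by
                  rw [mul_assoc, mul_assoc, ← exp_add, ← exp_add]; ring_nf
              _ ≤ _ := by gcongr
          linarith
  have h4 : 0 ≤ (1 + -x)^(N-1) := pow_nonneg (by linarith) _
  rw [abs_of_nonneg (by positivity)]
  calc _ ≤ exp (|q| *k + |v|/2) * exp (-b*v) * exp (1 - B * exp (-(|p| *k)) * exp (-v - |v|/2)) := by gcongr
    _ = _ := by rw [← exp_add, ← exp_add, ← exp_add, ← exp_add]; ring_nf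

theorem integral_asymptotics_prop
    (C C_plus A p q : ℝ) (hC : 0 < C) (hCC : C < C_plus) (hA : 0 < A) :
    ∃ δ₀ : ℝ, 0 < δ₀ ∧ ∀ δ : ℝ, 0 < δ → δ ≤ δ₀ →
      Tendsto
        (fun N : ℕ =>
          (∫ t in Ioc (0 : ℝ) δ,
              t ^ (q - 2) * Real.exp (-C_plus / t) *
                (1 - A * t ^ p * Real.exp (-C / t)) ^ (N - 1)) /
            (C ^ (q - 1) * (A * C ^ p) ^ (-(C_plus / C)) * Real.Gamma (C_plus / C) *
              Real.log N ^ (p * (C_plus / C) - q) * (N : ℝ) ^ (-(C_plus / C))))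
        atTop (𝓝 1) := by
  set b := C_plus / C with hbd
  have hb : 1 < b := by rw [hbd, one_lt_div hC]; exact hCC
  set B := A * C^p with hBd
  have hB : 0 < B := by positivity
  -- threshold
  obtain ⟨U, hU0, hU⟩ : ∃ U : ℝ, 0 < U ∧ ∀ u, U ≤ u → B * (u^(-p) * exp (-u)) ≤ 1 := by
    have h := (tendsto_rpow_mul_exp_neg_mul_atTop_nhds_zero (-p) 1 one_pos).const_mul B
    rw [mul_zero] at h
    obtain ⟨U, hU⟩ := eventually_atTop.1 (h.eventually_le_const one_pos)
    refine ⟨max U 1, by positivity, fun u hu => ?_⟩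
    simpa using hU u ((le_max_left _ _).trans hu)
  refine ⟨C/U, by positivity, ?_⟩
  intro δ hδ hδ0
  set M := C/δ with hMd
  have hM : 0 < M := by positivity
  have hUM : U ≤ M := by
    rw [hMd, le_div_iff₀ hδ]
    rw [le_div_iff₀ hU0] at hδ0
    linarith
  set ε := 1/(2*(|p|+|q|+1)) with hεd
  have hε : 0 < ε := by positivity
  have hεp : |p| * ε ≤ 1/2 := by
    rw [hεd, mul_one_div, div_le_div_iff₀ (by positivity) (by norm_num)]
    linarith [abs_nonneg p, abs_nonneg q]
  have hεq : |q| * ε ≤ 1/2 := by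
    rw [hεd, mul_one_div, div_le_div_iff₀ (by positivity) (by norm_num)]
    linarith [abs_nonneg p, abs_nonneg q]
  obtain ⟨k, hk0, hk⟩ := logr M ε hM hε
  obtain ⟨K, hK0, hK⟩ := dom b (B * exp (-(|p| *k))) hb (by positivity)
  let s : ℕ → ℝ := fun N => log N - p * log (log N)
  let G : ℕ → ℝ → ℝ := fun N v => ((s N + v)/log N)^(-q) * exp (-b*v) *
    (1 + -(B * ((s N + v)/log N)^(-p) * exp (-v)/N))^(N-1)
  let F : ℕ → ℝ → ℝ := fun N => (Ici (M - s N)).indicator (G N)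
  -- asymptotic facts
  have hL : Tendsto (fun N : ℕ => log (N:ℝ)) atTop atTop :=
    tendsto_log_atTop.comp tendsto_natCast_atTop_atTop
  have hlogdiv : Tendsto (fun N : ℕ => log (log (N:ℝ)) / log N) atTop (𝓝 0) :=
    (isLittleO_log_id_atTop.tendsto_div_nhds_zero).comp hL
  have hsdiv : Tendsto (fun N : ℕ => s N / log N) atTop (𝓝 1) := by
    have := (hlogdiv.const_mul p).const_sub 1
    rw [mul_zero, sub_zero] at this
    refine this.congr' ?_
    filter_upwards [hL.eventually_gt_atTop 0] with N hN
    simp only [s]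
    field_simp
  have hs : Tendsto s atTop atTop := by
    have := hsdiv.pos_mul_atTop one_pos hL
    refine this.congr' ?_
    filter_upwards [hL.eventually_gt_atTop 0] with N hN
    field_simp
  have hsbd : ∀ᶠ N : ℕ in atTop, |log N - s N| ≤ log N / 2 := by
    have h2 : Tendsto (fun N : ℕ => |1 - s N / log N|) atTop (𝓝 0) := by
      simpa using (hsdiv.const_sub 1).abs
    filter_upwards [hL.eventually_gt_atTop 0, h2.eventually_le_const (show (0:ℝ) < 1/2 by norm_num)] with N hN h
    have : log N - s N = log N * (1 - s N / log N) := by field_simp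
    rw [this, abs_mul, abs_of_pos hN]
    nlinarith
  have hdct : Tendsto (fun N => ∫ v, F N v) atTop (𝓝 (∫ v, exp (-b*v) * exp (-(B * exp (-v))))) := by
    apply tendsto_integral_filter_of_dominated_convergence
      (fun v => exp (1 + |q| *k) * (K * exp (-(1/2) * |v|)))
    · refine Eventually.of_forall fun N => ?_
      apply Measurable.aestronglyMeasurable
      apply Measurable.indicator _ measurableSet_Ici
      simp only [G]
      fun_prop
    · filter_upwards [hsbd, hL.eventually_ge_atTop 1, eventually_ge_atTop 1] with N h1 h2 hN
      refine ae_of_all _ fun v => ?_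
      simp only [F]
      by_cases hv : v ∈ Ici (M - s N)
      · rw [indicator_of_mem hv, norm_eq_abs]
        have hu : M ≤ s N + v := by have := mem_Ici.1 hv; linarith
        have hu0 : 0 < s N + v := by linarith
        have hL0 : 0 < log (N:ℝ) := by linarith
        have hN0 : (0:ℝ) < N := by exact_mod_cast hN
        refine (fb b B p q k ε hB hεp hεq _ v N hN (by positivity) (hk _ _ v (s N) h2 h1 rfl hu) ?_).trans ?_
        · refine le_trans (le_of_eq ?_) (hU _ (hUM.trans hu))
          have : exp (-(s N + v)) = exp (-v) / N * (log N)^p := by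
            rw [show -(s N + v) = -v + (-log N) + log (log N) * p by simp only [s]; ring]
            rw [exp_add, exp_add, ← rpow_def_of_pos hL0, exp_neg (log _), exp_log hN0]; ring
          rw [this, div_rpow hu0.le hL0.le, rpow_neg hL0.le]
          have := rpow_pos_of_pos hL0 p
          field_simp
        · exact mul_le_mul_of_nonneg_left (hK v) (exp_pos _).le
      · rw [indicator_of_notMem hv, norm_zero]; positivity
    · exact (intg.const_mul K).const_mul _
    · refine ae_of_all _ fun v => ?_
      have hr : Tendsto (fun N : ℕ => (s N + v)/log N) atTop (𝓝 1) := by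
        have := hsdiv.add (hL.const_div_atTop v)
        rw [add_zero] at this
        refine this.congr fun N => ?_
        rw [add_div]
      have ha : ∀ a : ℝ, Tendsto (fun N : ℕ => ((s N + v)/log N)^a) atTop (𝓝 1) := by
        intro a
        simpa using hr.rpow_const (p := a) (Or.inl one_ne_zero)
      have hG : Tendsto (fun N => G N v) atTop (𝓝 (1 * exp (-b*v) * exp (-(B * 1 * exp (-v))))) := by
        apply ((ha (-q)).mul_const _).mul
        apply lim1
        refine ((((ha (-p)).const_mul B).mul_const (exp (-v))).neg).congr' ?_
        filter_upwards [eventually_gt_atTop 0] with N hN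
        field_simp
      rw [one_mul, mul_one] at hG
      refine hG.congr' ?_
      filter_upwards [hs.eventually_ge_atTop (M - v)] with N hN
      simp only [F]
      rw [indicator_of_mem]
      rw [mem_Ici]; linarith
  rw [gam b B (by linarith) hB] at hdct
  have hGam : 0 < Real.Gamma b := Real.Gamma_pos_of_pos (by linarith)
  have hBb : 0 < B^(-b) := by positivity
  have hfin := hdct.div_const (B^(-b) * Real.Gamma b)
  rw [div_self (by positivity)] at hfin
  refine hfin.congr' ?_
  filter_upwards [hL.eventually_ge_atTop 1, eventually_ge_atTop 1] with N h2 hN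
  have hL0 : 0 < log (N:ℝ) := by linarith
  have hN0 : (0:ℝ) < N := by exact_mod_cast hN
  have hI : (∫ t in Ioc (0 : ℝ) δ,
              t ^ (q - 2) * Real.exp (-C_plus / t) *
                (1 - A * t ^ p * Real.exp (-C / t)) ^ (N - 1)) =
      (C^(q-1) * (log N)^(p*b-q) * (N:ℝ)^(-b)) * ∫ v, F N v := by
    rw [cov C δ (s N) hC hδ]
    simp only [F]
    rw [integral_indicator measurableSet_Ici, ← integral_const_mul]
    apply setIntegral_congr_fun measurableSet_Ici
    intro v hv
    exact ptw C C_plus A p q (s N + v) v (log N) (s N) N hC hA hN hL0 rfl rfl rfl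
      (by have := mem_Ici.1 hv; linarith)
  rw [hI]
  have := rpow_pos_of_pos hC (q-1)
  have := rpow_pos_of_pos hL0 (p*b-q)
  have := rpow_pos_of_pos hN0 (-b)
  rw [show C ^ (q - 1) * B ^ (-b) * Gamma b * log ↑N ^ (p * b - q) * ↑N ^ (-b) =
    (C ^ (q - 1) * log ↑N ^ (p * b - q) * (N:ℝ) ^ (-b)) * (B ^ (-b) * Gamma b) by ring]
  rw [mul_div_mul_left _ _ (by positivity)]
end

section
/- Let β > 1, A_0 > 0, and p, q ∈ ℝ. Then there exists δ_0 > 0 such that for all δ ∈ (0, δ_0], the integral J_N := ∫_0^δ t^{q−2} e^{−β/t} exp(−(N−1) A_0 t^p e^{−1/t}) dt satisfies J_N ∼ (A_0)^{−β} Γ(β) N^{−β} (ln N)^{pβ−q} as N → ∞. -/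
open MeasureTheory Filter Set Real
open scoped ENNReal Topology

lemma auxA (s ε : ℝ) (hε : 0 < ε) : ∃ K : ℝ, 0 < K ∧ ∀ u r : ℝ, 0 ≤ u → 0 < r →
    r ≤ 4 * (1 + u) → r⁻¹ ≤ 4 * (1 + u) → r ^ s ≤ K * exp (ε * u) := by
  set η := ε / (|s| + 1) with hη
  have hs := abs_nonneg s
  have hηp : 0 < η := by positivity
  refine ⟨(4 * (1 + 1 / η)) ^ |s|, by positivity, fun u r hu hr h1 h2 => ?_⟩
  have h3 : r ^ s ≤ (4 * (1 + u)) ^ |s| := by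
    rcases le_total 0 s with h | h
    · rw [abs_of_nonneg h]; exact rpow_le_rpow hr.le h1 h
    · rw [abs_of_nonpos h]
      have : r ^ s = (r⁻¹) ^ (-s) := by rw [inv_rpow hr.le, rpow_neg hr.le, inv_inv]
      rw [this]
      exact rpow_le_rpow (by positivity) h2 (by linarith)
  have h4 : 1 + u ≤ (1 + 1 / η) * exp (η * u) := by
    have ha : 1 ≤ exp (η * u) := one_le_exp (by positivity)
    have hb : η * u ≤ exp (η * u) := by linarith [add_one_le_exp (η * u)]
    have hc : u ≤ 1 / η * exp (η * u) := by
      rw [one_div, ← div_eq_inv_mul, le_div_iff₀ hηp]; linarith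
    linarith
  calc r ^ s ≤ (4 * (1 + u)) ^ |s| := h3
    _ ≤ (4 * (1 + 1 / η) * exp (η * u)) ^ |s| := by
        apply rpow_le_rpow (by positivity) _ hs; linarith
    _ = (4 * (1 + 1 / η)) ^ |s| * exp (η * u * |s|) := by
        rw [mul_rpow (by positivity) (by positivity), ← exp_mul]
    _ ≤ _ := by
        apply mul_le_mul_of_nonneg_left _ (by positivity)
        apply exp_le_exp.2
        have : η * |s| ≤ ε := by
          rw [hη, div_mul_eq_mul_div, div_le_iff₀ (by positivity)]; nlinarith
        calc η * u * |s| = η * |s| * u := by ring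
          _ ≤ ε * u := by gcongr

lemma auxB (γ c : ℝ) (hc : 0 < c) : ∃ K : ℝ, 0 < K ∧ ∀ w : ℝ, 0 ≤ w →
    exp (γ * w) * exp (-(c * exp (w / 2))) ≤ K * exp (-w) := by
  obtain ⟨n, hn⟩ := exists_nat_ge (2 * (γ + 1))
  refine ⟨n.factorial / c ^ n, by positivity, fun w hw => ?_⟩
  have h1 := pow_div_factorial_le_exp (c * exp (w / 2)) (by positivity) n
  have h2 : exp ((γ + 1) * w) ≤ exp (w / 2) ^ n := by
    rw [← exp_nat_mul]; apply exp_le_exp.2; nlinarith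
  rw [mul_pow, div_le_iff₀ (by positivity)] at h1
  have h3 : exp ((γ + 1) * w) = exp (γ * w) * exp w := by rw [← exp_add]; ring_nf
  rw [exp_neg, exp_neg, ← div_eq_mul_inv, ← div_eq_mul_inv, div_le_div_iff₀ (by positivity) (by positivity), ← h3,
    div_mul_eq_mul_div, le_div_iff₀ (by positivity)]
  calc _ ≤ exp (w / 2) ^ n * c ^ n := by gcongr
    _ ≤ _ := by linarith

lemma auxG (β A₀ : ℝ) (hβ : 0 < β) (hA₀ : 0 < A₀) :
    ∫ v : ℝ, exp (-β * v) * exp (-(A₀ * exp (-v))) = A₀ ^ (-β) * Real.Gamma β := by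
  have h := integral_rpow_mul_exp_neg_mul_Ioi hβ hA₀
  have him : (fun v : ℝ => exp (-v)) '' univ = Ioi 0 := by
    ext x; simp only [image_univ, mem_range, mem_Ioi]
    constructor
    · rintro ⟨y, rfl⟩; positivity
    · intro hx; exact ⟨-log x, by rw [neg_neg, exp_log hx]⟩
  rw [← him, integral_image_eq_integral_abs_deriv_smul (f' := fun v => -exp (-v)) MeasurableSet.univ
    (fun x _ => by simpa using ((hasDerivAt_neg x).exp))
    (fun x _ y _ hxy => by simpa using hxy)] at h
  rw [Measure.restrict_univ] at h
  rw [rpow_neg hA₀.le, ← inv_rpow hA₀.le, ← one_div, ← h]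
  congr 1; ext v
  rw [abs_neg, abs_of_pos (exp_pos _), smul_eq_mul, ← exp_mul, ← mul_assoc, ← exp_add, ← exp_add, ← exp_add]
  congr 1; ring

lemma auxI : Integrable (fun v : ℝ => exp (-|v|)) := by
  rw [← integrableOn_univ, ← Iic_union_Ioi (a := (0:ℝ))]
  refine IntegrableOn.union ?_ ?_
  · refine (integrableOn_exp_Iic 0).congr_fun (fun x hx => ?_) measurableSet_Iic
    simp only [abs_of_nonpos (show x ≤ 0 from hx), neg_neg]
  · refine (integrableOn_exp_neg_Ioi 0).congr_fun (fun x hx => ?_) measurableSet_Ioi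
    simp only [abs_of_pos (show 0 < x from hx)]

lemma auxDom (β A₀ p q : ℝ) (hβ : 1 < β) (hA₀ : 0 < A₀) : ∃ K : ℝ, 0 < K ∧ ∀ v r κ : ℝ, 0 < r →
    r ≤ 4 * (1 + |v|) → r⁻¹ ≤ 4 * (1 + |v|) → 1 / 2 ≤ κ →
    r ^ (-q) * exp (-β * v) * exp (-(κ * A₀ * r ^ (-p) * exp (-v))) ≤ K * exp (-|v|) := by
  obtain ⟨K1, hK1, H1⟩ := auxA (-q) (β - 1) (by linarith)
  obtain ⟨K2, hK2, H2⟩ := auxA p (1 / 2) (by norm_num)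
  obtain ⟨K3, hK3, H3⟩ := auxB (2 * β - 1) (A₀ / (2 * K2)) (by positivity)
  refine ⟨K1 * (1 + K3), by positivity, fun v r κ hr h1 h2 hκ => ?_⟩
  have a1 := H1 |v| r (abs_nonneg v) hr h1 h2
  have a2 := H2 |v| r (abs_nonneg v) hr h1 h2
  rcases le_total 0 v with hv | hv
  · rw [abs_of_nonneg hv] at *
    have : exp (-(κ * A₀ * r ^ (-p) * exp (-v))) ≤ 1 := by
      apply exp_le_one_iff.2
      have : 0 ≤ κ * A₀ * r ^ (-p) * exp (-v) := by positivity
      linarith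
    calc _ ≤ K1 * exp ((β - 1) * v) * exp (-β * v) * 1 := by gcongr
      _ = K1 * exp (-v) := by
        rw [mul_one, mul_assoc, ← exp_add]; congr 2; ring
      _ ≤ _ := by
        apply mul_le_mul_of_nonneg_right _ (exp_pos _).le
        nlinarith
  · rw [abs_of_nonpos hv] at *
    have b := H3 (-v) (by linarith)
    have hrp : 1 / K2 * exp (-(1 / 2 * -v)) ≤ r ^ (-p) := by
      rw [rpow_neg hr.le, exp_neg, one_div, ← mul_inv]
      exact inv_anti₀ (by positivity) a2
    have c : exp (-(κ * A₀ * r ^ (-p) * exp (-v))) ≤ exp (-(A₀ / (2 * K2) * exp (-v / 2))) := by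
      apply exp_le_exp.2
      apply neg_le_neg
      calc A₀ / (2 * K2) * exp (-v / 2)
          = 1 / 2 * A₀ * (1 / K2 * exp (-(1 / 2 * -v))) * exp (-v) := by
            have : exp (-v / 2) = exp (-(1 / 2 * -v)) * exp (-v) := by
              rw [← exp_add]; congr 1; ring
            rw [this]; field_simp
        _ ≤ _ := by gcongr
    calc _ ≤ K1 * exp ((β - 1) * -v) * exp (-β * v) * exp (-(A₀ / (2 * K2) * exp (-v / 2))) := by gcongr
      _ = K1 * (exp ((2 * β - 1) * -v) * exp (-(A₀ / (2 * K2) * exp (-v / 2)))) := by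
        have : exp ((2 * β - 1) * -v) = exp ((β - 1) * -v) * exp (-β * v) := by
          rw [← exp_add]; congr 1; ring
        rw [this]; ring
      _ ≤ K1 * (K3 * exp (- -v)) := by gcongr
      _ ≤ _ := by
        rw [← mul_assoc]
        apply mul_le_mul_of_nonneg_right _ (exp_pos _).le
        nlinarith

lemma auxCV (β A₀ p q δ N L m : ℝ) (hδ : 0 < δ) (hN : 0 < N) (hL : 0 < L)
    (hNL : log N = L) (hm : m = L - p * log L) :
    (∫ t in Ioc (0 : ℝ) δ, t ^ (q - 2) * exp (-β / t) *
                exp (-(N - 1) * A₀ * t ^ p * exp (-1 / t)))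
     = N ^ (-β) * L ^ (p * β - q) * ∫ v : ℝ, indicator (Ici (δ⁻¹ - m)) (fun v =>
        ((m + v) / L) ^ (-q) * exp (-β * v) *
          exp (-((N - 1) / N * A₀ * ((m + v) / L) ^ (-p) * exp (-v)))) v := by
  have hδi : 0 < δ⁻¹ := by positivity
  have him : (fun v : ℝ => (m + v)⁻¹) '' Ici (δ⁻¹ - m) = Ioc 0 δ := by
    ext x; simp only [mem_image, mem_Ici, mem_Ioc]
    constructor
    · rintro ⟨y, hy, rfl⟩
      have : δ⁻¹ ≤ m + y := by linarith
      exact ⟨inv_pos.2 (by linarith), inv_le_of_inv_le₀ hδ this⟩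
    · rintro ⟨hx, hx2⟩
      refine ⟨x⁻¹ - m, ?_, by simp⟩
      have := inv_anti₀ hx hx2
      linarith
  rw [← him, integral_image_eq_integral_abs_deriv_smul (f' := fun v => -1 / (m + v) ^ 2)
    measurableSet_Ici
    (fun x hx => by
      have hx : δ⁻¹ - m ≤ x := hx
      have h0 : m + x ≠ 0 := by linarith
      exact (((hasDerivAt_id x).const_add m).inv h0).hasDerivWithinAt)
    (fun x _ y _ hxy => by simpa using hxy), integral_indicator measurableSet_Ici,
    ← integral_const_mul]
  refine setIntegral_congr_fun measurableSet_Ici (fun v hv => ?_)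
  have hv : δ⁻¹ - m ≤ v := hv
  have hs : 0 < m + v := by linarith
  have hem : exp (-m) = N⁻¹ * L ^ p := by
    rw [hm, rpow_def_of_pos hL, ← exp_log (inv_pos.2 hN), log_inv, hNL, ← exp_add]; congr 1; ring
  have hemβ : exp (-β * m) = N ^ (-β) * L ^ (p * β) := by
    rw [hm, rpow_def_of_pos hL, rpow_def_of_pos hN, hNL, ← exp_add]; congr 1; ring
  simp only [smul_eq_mul]
  generalize hsd : m + v = s at *
  have e1 : |(-1 / s ^ 2)| * s⁻¹ ^ (q - 2) = s ^ (-q) := by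
    have : |(-1 / s ^ 2)| = s ^ (-2 : ℝ) := by
      rw [neg_div, abs_neg, abs_of_pos (by positivity), rpow_neg hs.le]; norm_num
    rw [this, inv_rpow hs.le, ← rpow_neg hs.le, ← rpow_add hs]; congr 1; ring
  have e2 : exp (-β / s⁻¹) = N ^ (-β) * L ^ (p * β) * exp (-β * v) := by
    rw [← hemβ, ← exp_add, ← hsd, div_inv_eq_mul]; congr 1; ring
  have e3 : exp (-1 / s⁻¹) = N⁻¹ * L ^ p * exp (-v) := by
    rw [← hem, ← exp_add, ← hsd, div_inv_eq_mul]; congr 1; ring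
  have e4 : (s / L) ^ (-q) = s ^ (-q) * L ^ q := by
    rw [div_rpow hs.le hL.le, rpow_neg hL.le, div_inv_eq_mul]
  have e5 : (s / L) ^ (-p) = s⁻¹ ^ p * L ^ p := by
    rw [div_rpow hs.le hL.le, rpow_neg hL.le, div_inv_eq_mul, rpow_neg hs.le, inv_rpow hs.le]
  have e6 : L ^ (p * β - q) * L ^ q = L ^ (p * β) := by
    rw [← rpow_add hL]; congr 1; ring
  have e7 : -(N - 1) * A₀ * s⁻¹ ^ p * (N⁻¹ * L ^ p * exp (-v)) =
      -((N - 1) / N * A₀ * (s⁻¹ ^ p * L ^ p) * exp (-v)) := by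
    rw [div_eq_mul_inv]; ring
  rw [e2, e3, e4, e5, e7, ← e6, ← mul_assoc, ← mul_assoc, e1]
  ring

lemma auxBd (a L m v : ℝ) (ha : 1 ≤ a) (hL : 1 ≤ L) (hm1 : L / 2 ≤ m) (hm2 : m ≤ 2 * L)
    (hv : a - m ≤ v) : 0 < (m + v) / L ∧ (m + v) / L ≤ 4 * (1 + |v|) ∧
      ((m + v) / L)⁻¹ ≤ 4 * (1 + |v|) := by
  have hs : 0 < m + v := by linarith
  refine ⟨by positivity, ?_, ?_⟩
  · rw [div_le_iff₀ (by linarith)]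
    nlinarith [le_abs_self v, abs_nonneg v]
  · rw [inv_div, div_le_iff₀ hs]
    rcases le_total 0 v with h | h
    · rw [abs_of_nonneg h]; nlinarith
    · rw [abs_of_nonpos h]
      rcases le_total (-v) (m / 2) with h' | h'
      · nlinarith
      · nlinarith

theorem integral_asymptotics_exponential_weight
    (β A₀ p q : ℝ) (hβ : 1 < β) (hA₀ : 0 < A₀) :
    ∃ δ₀ : ℝ, 0 < δ₀ ∧ ∀ δ : ℝ, 0 < δ → δ ≤ δ₀ →
      Tendsto
        (fun N : ℕ =>
          (∫ t in Ioc (0 : ℝ) δ,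
              t ^ (q - 2) * Real.exp (-β / t) *
                Real.exp (-((N : ℝ) - 1) * A₀ * t ^ p * Real.exp (-1 / t))) /
            (A₀ ^ (-β) * Real.Gamma β * (N : ℝ) ^ (-β) * Real.log N ^ (p * β - q)))
        atTop (𝓝 1) := by
  refine ⟨1, one_pos, fun δ hδ hδ1 => ?_⟩
  have ha : 1 ≤ δ⁻¹ := (one_le_inv₀ hδ).2 hδ1
  obtain ⟨K, hK, HK⟩ := auxDom β A₀ p q hβ hA₀
  set L : ℕ → ℝ := fun N => log N with hLdef
  set m : ℕ → ℝ := fun N => L N - p * log (L N) with hmdef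
  have hLt : Tendsto L atTop atTop := tendsto_log_atTop.comp tendsto_natCast_atTop_atTop
  have hlog : Tendsto (fun N => log (L N) / L N) atTop (𝓝 0) :=
    (isLittleO_log_id_atTop.tendsto_div_nhds_zero).comp hLt
  have hL1 : ∀ᶠ N in atTop, 1 ≤ L N := hLt.eventually_ge_atTop 1
  have hmL : Tendsto (fun N => m N / L N) atTop (𝓝 1) := by
    have : Tendsto (fun N => 1 - p * (log (L N) / L N)) atTop (𝓝 (1 - p * 0)) :=
      tendsto_const_nhds.sub (hlog.const_mul p)
    rw [mul_zero, sub_zero] at this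
    refine this.congr' ?_
    filter_upwards [hL1] with N hN
    have : L N ≠ 0 := by linarith
    simp only [hmdef]; field_simp
  have hm1 : ∀ᶠ N in atTop, L N / 2 ≤ m N := by
    filter_upwards [hL1, hmL.eventually_const_le (show (1/2:ℝ) < 1 by norm_num)] with N h1 h2
    rw [le_div_iff₀ (by linarith)] at h2; linarith
  have hm2 : ∀ᶠ N in atTop, m N ≤ 2 * L N := by
    filter_upwards [hL1, hmL.eventually_le_const (show (1:ℝ) < 2 by norm_num)] with N h1 h2
    rwa [div_le_iff₀ (by linarith)] at h2
  have hκt : Tendsto (fun N : ℕ => ((N : ℝ) - 1) / N) atTop (𝓝 1) := by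
    have : Tendsto (fun N : ℕ => 1 - 1 / (N : ℝ)) atTop (𝓝 (1 - 0)) :=
      tendsto_const_nhds.sub tendsto_one_div_atTop_nhds_zero_nat
    rw [sub_zero] at this
    refine this.congr' ?_
    filter_upwards [eventually_gt_atTop 0] with N hN
    have : (N : ℝ) ≠ 0 := by positivity
    field_simp
  have hκ : ∀ᶠ N : ℕ in atTop, 1 / 2 ≤ ((N : ℝ) - 1) / N :=
    hκt.eventually_const_le (by norm_num)
  have hmt : Tendsto m atTop atTop :=
    tendsto_atTop_mono' _ hm1 (hLt.atTop_div_const (by norm_num))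
  set F : ℕ → ℝ → ℝ := fun N => indicator (Ici (δ⁻¹ - m N)) (fun v =>
        ((m N + v) / L N) ^ (-q) * exp (-β * v) *
          exp (-(((N : ℝ) - 1) / N * A₀ * ((m N + v) / L N) ^ (-p) * exp (-v)))) with hF
  have hlim : Tendsto (fun N => ∫ v, F N v) atTop (𝓝 (A₀ ^ (-β) * Real.Gamma β)) := by
    rw [← auxG β A₀ (by linarith) hA₀]
    refine tendsto_integral_filter_of_dominated_convergence (fun v => K * exp (-|v|)) ?_ ?_
      (auxI.const_mul K) ?_
    · refine Eventually.of_forall fun N => ?_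
      refine (Measurable.indicator ?_ measurableSet_Ici).aestronglyMeasurable
      fun_prop
    · filter_upwards [hL1, hm1, hm2, hκ] with N h1 h2 h3 h4
      refine Eventually.of_forall fun v => ?_
      by_cases hv : v ∈ Ici (δ⁻¹ - m N)
      · obtain ⟨b1, b2, b3⟩ := auxBd δ⁻¹ (L N) (m N) v ha h1 h2 h3 hv
        simp only [hF, indicator_of_mem hv]
        rw [norm_of_nonneg (by positivity)]
        exact HK v _ _ b1 b2 b3 h4
      · simp only [hF, indicator_of_notMem hv, norm_zero]
        positivity
    · refine Eventually.of_forall fun v => ?_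
      have hr : Tendsto (fun N => (m N + v) / L N) atTop (𝓝 1) := by
        have := hmL.add (hLt.const_div_atTop v)
        rw [add_zero] at this
        refine this.congr fun N => ?_
        rw [add_div]
      have h1 := hr.rpow_const (p := -q) (Or.inl one_ne_zero)
      have h2 := hr.rpow_const (p := -p) (Or.inl one_ne_zero)
      rw [one_rpow] at h1 h2
      have h3 := (h1.mul_const (exp (-β * v))).mul
        ((((hκt.mul_const A₀).mul h2).mul_const (exp (-v))).neg.rexp)
      simp only [one_mul, mul_one] at h3
      refine h3.congr' ?_
      filter_upwards [hmt.eventually_ge_atTop (δ⁻¹ - v)] with N hN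
      have hv : v ∈ Ici (δ⁻¹ - m N) := by simp only [mem_Ici]; linarith
      simp only [hF, indicator_of_mem hv]
  have hG : 0 < A₀ ^ (-β) * Real.Gamma β :=
    mul_pos (by positivity) (Real.Gamma_pos_of_pos (by linarith))
  have hfin := hlim.div_const (A₀ ^ (-β) * Real.Gamma β)
  rw [div_self hG.ne'] at hfin
  refine hfin.congr' ?_
  filter_upwards [hL1, eventually_gt_atTop 0] with N h1 h2
  have hN : (0 : ℝ) < N := by exact_mod_cast h2
  have hLp : 0 < L N := by linarith
  rw [auxCV β A₀ p q δ N (L N) (m N) hδ hN hLp rfl rfl]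
  have e1 : 0 < (N : ℝ) ^ (-β) := by positivity
  have e2 : 0 < L N ^ (p * β - q) := by positivity
  change _ = (N : ℝ) ^ (-β) * L N ^ (p * β - q) * (∫ v, F N v) /
    (A₀ ^ (-β) * Real.Gamma β * (N : ℝ) ^ (-β) * L N ^ (p * β - q))
  rw [mul_assoc (A₀ ^ (-β) * Real.Gamma β), mul_comm (A₀ ^ (-β) * Real.Gamma β),
    mul_div_mul_left _ _ (by positivity)]
end

section
/- Let erfc(z) := (2/√π) ∫_z^∞ e^{−u²} du and, for s > 0 and w ∈ (0,1), let Φ(s, w) := Σ_{k∈ℤ} sgn(2k + w) · erfc(|2k + w| / (2√s)). Fix D > 0, l > 0, and x_0 ∈ (0, l/2), and define F(t) := Φ(Dt/l², x_0/l) + Φ(Dt/l², 1 − x_0/l) for t > 0. Then F(t) ∼ √(4D/(π x_0²)) · t^{1/2} · e^{−x_0²/(4Dt)} as t → 0+. -/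
open MeasureTheory Filter Set Real
open scoped Topology

/-- The complementary error function `erfc z = (2/√π) ∫_z^∞ e^{-u²} du`. -/
noncomputable def erfc (z : ℝ) : ℝ :=
  (2 / Real.sqrt Real.pi) * ∫ u in Set.Ioi z, Real.exp (-u ^ 2)

/-- The short-time expansion `Φ(s,w) = Σ_{k∈ℤ} sgn(2k+w) erfc(|2k+w|/(2√s))` of the
distribution function of the exit time of Brownian motion from an interval. -/
noncomputable def PhiShort (s w : ℝ) : ℝ :=
  ∑' k : ℤ, Real.sign (2 * (k : ℝ) + w) * erfc (|2 * (k : ℝ) + w| / (2 * Real.sqrt s))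

noncomputable def HH (z : ℝ) : ℝ := Real.exp (-z ^ 2) / (z * Real.sqrt Real.pi)

theorem HH_pos {z : ℝ} (hz : 0 < z) : 0 < HH z := by
  unfold HH; positivity

theorem gauss_int (z : ℝ) : IntegrableOn (fun u : ℝ => Real.exp (-u ^ 2)) (Set.Ioi z) := by
  have := integrable_exp_neg_mul_sq (b := 1) one_pos
  simp only [neg_mul, one_mul] at this
  exact this.integrableOn

theorem aux_deriv {x : ℝ} (hx : 0 < x) :
    HasDerivAt (fun u : ℝ => -(Real.exp (-u ^ 2) / (2 * u)))
      (Real.exp (-x ^ 2) * (1 + 1 / (2 * x ^ 2))) x := by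
  have h1 : HasDerivAt (fun u : ℝ => -u ^ 2) (-(2 * x)) x := by
    exact (hasDerivAt_pow 2 x).neg.congr_deriv (by simp)
  have h2 : HasDerivAt (fun u : ℝ => 2 * u) 2 x := by
    simpa using (hasDerivAt_id x).const_mul 2
  have h3 := (h1.exp.div h2 (by positivity)).neg
  refine h3.congr_deriv ?_
  field_simp
  ring

theorem aux_tendsto :
    Tendsto (fun u : ℝ => -(Real.exp (-u ^ 2) / (2 * u))) atTop (𝓝 0) := by
  have h1 : Tendsto (fun u : ℝ => 1 / (2 * u)) atTop (𝓝 0) := by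
    have : Tendsto (fun u : ℝ => 2 * u) atTop atTop :=
      tendsto_id.const_mul_atTop (by norm_num)
    exact this.inv_tendsto_atTop.congr (fun u => by simp)
  have h2 : Tendsto (fun u : ℝ => Real.exp (-u ^ 2) / (2 * u)) atTop (𝓝 0) := by
    refine squeeze_zero' ?_ ?_ h1
    · filter_upwards [eventually_gt_atTop 0] with u hu
      positivity
    · filter_upwards [eventually_gt_atTop 0] with u hu
      gcongr
      apply Real.exp_le_one_iff.2
      nlinarith [sq_nonneg u]
  simpa using h2.neg

theorem aux_int {z : ℝ} (hz : 0 < z) :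
    IntegrableOn (fun x : ℝ => Real.exp (-x ^ 2) * (1 + 1 / (2 * x ^ 2))) (Set.Ioi z) ∧
    ∫ x in Set.Ioi z, Real.exp (-x ^ 2) * (1 + 1 / (2 * x ^ 2)) = Real.exp (-z ^ 2) / (2 * z) := by
  have hd : ∀ x ∈ Set.Ici z, HasDerivAt (fun u : ℝ => -(Real.exp (-u ^ 2) / (2 * u)))
      (Real.exp (-x ^ 2) * (1 + 1 / (2 * x ^ 2))) x :=
    fun x hx => aux_deriv (lt_of_lt_of_le hz hx)
  have hi := integrableOn_Ioi_deriv_of_nonneg' hd (fun x _ => by positivity) aux_tendsto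
  refine ⟨hi, ?_⟩
  rw [integral_Ioi_of_hasDerivAt_of_tendsto' hd hi aux_tendsto]
  ring

theorem erfc_nonneg (z : ℝ) : 0 ≤ erfc z := by
  unfold erfc
  have : 0 ≤ ∫ u in Set.Ioi z, Real.exp (-u ^ 2) := integral_nonneg (fun u => (Real.exp_pos _).le)
  positivity

theorem HH_eq {z : ℝ} (hz : 0 < z) :
    HH z = (2 / Real.sqrt Real.pi) * (Real.exp (-z ^ 2) / (2 * z)) := by
  unfold HH
  field_simp

theorem erfc_le {z : ℝ} (hz : 0 < z) : erfc z ≤ HH z := by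
  rw [HH_eq hz, ← (aux_int hz).2]
  unfold erfc
  refine mul_le_mul_of_nonneg_left ?_ (by positivity)
  refine setIntegral_mono_on (gauss_int z) (aux_int hz).1 measurableSet_Ioi ?_
  intro x hx
  have : 0 ≤ 1 / (2 * x ^ 2) := by positivity
  nlinarith [Real.exp_pos (-x ^ 2)]

theorem le_erfc {z : ℝ} (hz : 0 < z) : HH z ≤ erfc z * (1 + 1 / (2 * z ^ 2)) := by
  rw [HH_eq hz, ← (aux_int hz).2]
  unfold erfc
  rw [mul_assoc, ← integral_mul_const]
  refine mul_le_mul_of_nonneg_left ?_ (by positivity)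
  refine setIntegral_mono_on (aux_int hz).1 ((gauss_int z).mul_const _) measurableSet_Ioi ?_
  intro x hx
  have hx : z < x := hx
  gcongr

theorem ratio_tendsto : Tendsto (fun z : ℝ => erfc z / HH z) atTop (𝓝 1) := by
  have h1 : Tendsto (fun z : ℝ => (1 + 1 / (2 * z ^ 2))⁻¹) atTop (𝓝 1) := by
    have h : Tendsto (fun u : ℝ => 2 * u ^ 2) atTop atTop :=
      (tendsto_pow_atTop (by norm_num)).const_mul_atTop (by norm_num)
    have h' := (h.inv_tendsto_atTop.const_add 1).inv₀ (by norm_num)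
    simpa using h'
  refine tendsto_of_tendsto_of_tendsto_of_le_of_le' h1 tendsto_const_nhds ?_ ?_
  · filter_upwards [eventually_gt_atTop 0] with z hz
    have := le_erfc hz
    rw [le_div_iff₀ (HH_pos hz), inv_mul_le_iff₀ (by positivity)]
    linarith
  · filter_upwards [eventually_gt_atTop 0] with z hz
    rw [div_le_one (HH_pos hz)]
    exact erfc_le hz

theorem term_bound {v w a : ℝ} (hw : 0 < w) (hv : w ≤ v) (ha : 0 < a) :
    erfc (v * a) / HH (w * a) ≤ Real.exp (-(v ^ 2 - w ^ 2) * a ^ 2) := by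
  have hv0 : 0 < v := hw.trans_le hv
  rw [div_le_iff₀ (HH_pos (by positivity))]
  refine (erfc_le (by positivity)).trans ?_
  unfold HH
  rw [← mul_div_assoc, ← Real.exp_add]
  have : -(v ^ 2 - w ^ 2) * a ^ 2 + -(w * a) ^ 2 = -(v * a) ^ 2 := by ring
  rw [this]
  gcongr

theorem term_zero {v w : ℝ} (hw : 0 < w) (hv : w < v) :
    Tendsto (fun a : ℝ => erfc (v * a) / HH (w * a)) atTop (𝓝 0) := by
  have h0 : 0 < v ^ 2 - w ^ 2 := by nlinarith
  have h : Tendsto (fun a : ℝ => Real.exp (-(v ^ 2 - w ^ 2) * a ^ 2)) atTop (𝓝 0) := by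
    apply Real.tendsto_exp_atBot.comp
    exact (tendsto_pow_atTop (by norm_num)).const_mul_atTop_of_neg (by linarith)
  refine squeeze_zero' ?_ ?_ h
  · filter_upwards [eventually_gt_atTop 0] with a ha
    exact div_nonneg (erfc_nonneg _) (HH_pos (by positivity)).le
  · filter_upwards [eventually_gt_atTop 0] with a ha
    exact term_bound hw hv.le ha

theorem term_one {w : ℝ} (hw : 0 < w) :
    Tendsto (fun a : ℝ => erfc (w * a) / HH (w * a)) atTop (𝓝 1) :=
  ratio_tendsto.comp (tendsto_id.const_mul_atTop hw)

theorem summable_bd : Summable (fun k : ℤ => Real.exp (-|(k : ℝ)|)) := by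
  have h : Summable (fun n : ℕ => Real.exp (-(n : ℝ))) := Real.summable_exp_neg_nat
  refine Summable.of_nat_of_neg ?_ ?_ <;> simpa using h

theorem key {u b : ℝ} (hu0 : 0 < u) (hu1 : u < 1) (hb : 0 < b) (c : ℤ → ℝ)
    (hbu : ∀ k : ℤ, b ≤ |2 * (k : ℝ) + u|)
    (hc : ∀ k : ℤ, Tendsto (fun a : ℝ => Real.sign (2 * (k : ℝ) + u) *
      erfc (|2 * (k : ℝ) + u| * a) / HH (b * a)) atTop (𝓝 (c k))) :
    Tendsto (fun a : ℝ => (∑' k : ℤ, Real.sign (2 * (k : ℝ) + u) *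
      erfc (|2 * (k : ℝ) + u| * a)) / HH (b * a)) atTop (𝓝 (∑' k, c k)) := by
  simp_rw [← tsum_div_const]
  refine tendsto_tsum_of_dominated_convergence
    (bound := fun k : ℤ => Real.exp (3 + b ^ 2) * Real.exp (-|(k : ℝ)|))
    (summable_bd.mul_left _) hc ?_
  filter_upwards [eventually_ge_atTop 1] with a ha k
  have ha0 : 0 < a := by linarith
  have hH : 0 < HH (b * a) := HH_pos (by positivity)
  have hs : |Real.sign (2 * (k : ℝ) + u)| ≤ 1 := by
    rcases Real.sign_apply_eq (2 * (k : ℝ) + u) with h | h | h <;> rw [h] <;> norm_num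
  rw [mul_div_assoc, Real.norm_eq_abs, abs_mul,
    abs_of_nonneg (div_nonneg (erfc_nonneg _) hH.le)]
  have hq := div_nonneg (erfc_nonneg (|2 * (k : ℝ) + u| * a)) hH.le
  have h1 := term_bound hb (hbu k) ha0
  have hbk := hbu k
  set v := |2 * (k : ℝ) + u| with hv
  have h2 : Real.exp (-(v ^ 2 - b ^ 2) * a ^ 2) ≤
      Real.exp (3 + b ^ 2) * Real.exp (-|(k : ℝ)|) := by
    rw [← Real.exp_add]
    apply Real.exp_le_exp.2
    have h3 : 0 ≤ v ^ 2 - b ^ 2 := by nlinarith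
    have h4 : 2 * |(k : ℝ)| - 1 ≤ v := by
      have := abs_sub_abs_le_abs_sub (2 * (k : ℝ)) (-u)
      rw [abs_neg, abs_of_pos hu0, sub_neg_eq_add, abs_mul, abs_two] at this
      linarith
    have h5 : 0 ≤ (v ^ 2 - b ^ 2) * (a ^ 2 - 1) := mul_nonneg h3 (by nlinarith)
    nlinarith [sq_nonneg (v - 1), abs_nonneg (k : ℝ)]
  calc _ ≤ 1 * (erfc (v * a) / HH (b * a)) := by gcongr
    _ ≤ _ := by linarith

theorem main_a {w : ℝ} (hw : 0 < w) (hw2 : w < 1 / 2) :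
    Tendsto (fun a : ℝ => ((∑' k : ℤ, Real.sign (2 * (k : ℝ) + w) *
      erfc (|2 * (k : ℝ) + w| * a)) + (∑' k : ℤ, Real.sign (2 * (k : ℝ) + (1 - w)) *
      erfc (|2 * (k : ℝ) + (1 - w)| * a))) / HH (w * a)) atTop (𝓝 1) := by
  have hk : ∀ k : ℤ, k ≠ 0 → w < |2 * (k : ℝ) + w| := by
    intro k hk
    rw [lt_abs]
    rcases lt_or_gt_of_ne hk with h | h
    · right
      have : (k : ℝ) ≤ -1 := by exact_mod_cast (by omega : k ≤ -1)
      linarith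
    · left
      have : (1 : ℝ) ≤ k := by exact_mod_cast (by omega : 1 ≤ k)
      linarith
  have hk' : ∀ k : ℤ, w < |2 * (k : ℝ) + (1 - w)| := by
    intro k
    rw [lt_abs]
    rcases lt_or_ge k 0 with h | h
    · right
      have : (k : ℝ) ≤ -1 := by exact_mod_cast (by omega : k ≤ -1)
      linarith
    · left
      have : (0 : ℝ) ≤ k := by exact_mod_cast h
      linarith
  have A := key (u := w) (b := w) hw (by linarith) hw (fun k => if k = 0 then 1 else 0)
    (by
      intro k
      by_cases h : k = 0
      · subst h; simp [le_abs_self]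
      · exact (hk k h).le)
    (by
      intro k
      by_cases h : k = 0
      · subst h
        simpa [Real.sign_of_pos hw, abs_of_pos hw] using term_one hw
      · simp only [h, if_false, mul_div_assoc]
        simpa using (term_zero hw (hk k h)).const_mul (Real.sign (2 * (k : ℝ) + w)))
  have B := key (u := 1 - w) (b := w) (by linarith) (by linarith) hw (fun k => 0)
    (fun k => (hk' k).le)
    (by
      intro k
      simp only [mul_div_assoc]
      simpa using (term_zero hw (hk' k)).const_mul (Real.sign (2 * (k : ℝ) + (1 - w))))
  have C := A.add B
  simp only [← add_div] at C
  simpa using C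

theorem exit_time_short_time_asymptotics
    (D l x₀ : ℝ) (hD : 0 < D) (hl : 0 < l) (hx₀ : 0 < x₀) (hx₀l : x₀ < l / 2)
    (F : ℝ → ℝ)
    (hF : ∀ t : ℝ, F t = PhiShort (D * t / l ^ 2) (x₀ / l)
        + PhiShort (D * t / l ^ 2) (1 - x₀ / l)) :
    Tendsto
      (fun t : ℝ =>
        F t / (Real.sqrt (4 * D / (Real.pi * x₀ ^ 2)) * t ^ ((1 : ℝ) / 2) *
          Real.exp (-(x₀ ^ 2) / (4 * D * t))))
      (𝓝[>] 0) (𝓝 1) := by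
  have hw : 0 < x₀ / l := by positivity
  have hw2 : x₀ / l < 1 / 2 := by rw [div_lt_iff₀ hl]; linarith
  have ht : Tendsto (fun t : ℝ => (2 * Real.sqrt (D * t / l ^ 2))⁻¹) (𝓝[>] 0) atTop := by
    apply Tendsto.inv_tendsto_nhdsGT_zero
    rw [tendsto_nhdsWithin_iff]
    constructor
    · have : Continuous (fun t : ℝ => 2 * Real.sqrt (D * t / l ^ 2)) := by fun_prop
      have h := this.tendsto 0
      simp only [mul_zero, zero_div, Real.sqrt_zero] at h
      exact h.mono_left nhdsWithin_le_nhds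
    · filter_upwards [self_mem_nhdsWithin] with t ht
      have : 0 < t := ht
      show 0 < 2 * Real.sqrt (D * t / l ^ 2)
      positivity
  refine ((main_a hw hw2).comp ht).congr' ?_
  filter_upwards [self_mem_nhdsWithin] with t ht
  have ht : 0 < t := ht
  simp only [Function.comp, hF, PhiShort, div_eq_mul_inv _ (2 * Real.sqrt (D * t / l ^ 2))]
  congr 1
  have e1 : Real.sqrt (D * t / l ^ 2) = Real.sqrt D * Real.sqrt t / l := by
    rw [Real.sqrt_div (by positivity), Real.sqrt_mul hD.le, Real.sqrt_sq hl.le]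
  have e2 : Real.sqrt (4 * D / (Real.pi * x₀ ^ 2)) = 2 * Real.sqrt D / (Real.sqrt Real.pi * x₀) := by
    rw [Real.sqrt_div (by positivity), Real.sqrt_mul (by norm_num), Real.sqrt_mul Real.pi_pos.le,
      Real.sqrt_sq hx₀.le, show (4 : ℝ) = 2 ^ 2 by norm_num, Real.sqrt_sq (by norm_num)]
  have hsD := Real.sq_sqrt hD.le
  have hst := Real.sq_sqrt ht.le
  have hsD0 := Real.sqrt_pos.2 hD
  have hst0 := Real.sqrt_pos.2 ht
  have e3 : x₀ / l * (2 * Real.sqrt (D * t / l ^ 2))⁻¹ = x₀ / (2 * (Real.sqrt D * Real.sqrt t)) := by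
    rw [e1]; field_simp
  have e4 : -(x₀ / (2 * (Real.sqrt D * Real.sqrt t))) ^ 2 = -(x₀ ^ 2) / (4 * D * t) := by
    rw [div_pow, mul_pow, mul_pow, hsD, hst]; ring
  rw [e3, HH, e4, e2, ← Real.sqrt_eq_rpow]
  field_simp
end
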